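/- With X_n, Y_n the Cantor-type sets built from parameters m₁ ≤ m₂ (L = 2^{m₁+m₂}, Y_n = L^n X_n), the function f = F_W(1_{Y_n}) is supported on X_n and its Walsh transform is 1_{Y_n}; hence f is a nonzero function supported on X_n whose Walsh transform is supported on Y_n. -/

import Mathlib

open MeasureTheory Set

noncomputable section

/-- The binary digit of `x ≥ 0` in position `k` (the coefficient of `2^k` in the binary
expansion `x = ∑_k x_k 2^k`). -/
def rbit (x : ℝ) (k : ℤ) : ℕ := (⌊x / (2:ℝ) ^ k⌋ % 2).toNat

/-- The `k`-th binary digit of the dyadic convolution product: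
`c_k = ∑_{j ∈ ℤ} x_j y_{k-j} (mod 2)` (the sum is always finite). -/
def dprodDigit (x y : ℝ) (k : ℤ) : ℕ :=
  {j : ℤ | rbit x j = 1 ∧ rbit y (k - j) = 1}.ncard % 2

/-- The dyadic convolution product `x ⊗ y := ∑_k c_k 2^k`. -/
def dprod (x y : ℝ) : ℝ := ∑' k : ℤ, (dprodDigit x y k : ℝ) * (2:ℝ) ^ k

/-- The Walsh exponential `e_W(x) = (-1)^{x_{-1}}`, where `x_{-1}` is the first binary
digit of `x` after the point. -/
def eW (x : ℝ) : ℝ := (-1 : ℝ) ^ rbit x (-1)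

/-- The Walsh transform `F_W f(y) = ∫_{[0,∞)} e_W(x ⊗ y) f(x) dx`. -/
def walshTransform (f : ℝ → ℂ) (y : ℝ) : ℂ :=
  ∫ x in Set.Ici (0:ℝ), (eW (dprod x y) : ℂ) * f x

/-- `x` is a dyadic rational. -/
def IsDyadic (x : ℝ) : Prop := ∃ (n : ℤ) (k : ℕ), x = (n : ℝ) / 2 ^ k
/-- The set of left endpoints `A_n = {∑_{i=1}^n k_{n-i+1} 2^{m₁} L^{-i}}`, where
`L = 2^{m₁+m₂}` and the digits `k_i` range over `{0, …, 2^{m₂}-1}`. -/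
def Aset (m₁ m₂ n : ℕ) : Set ℝ :=
  {x | ∃ k : Fin n → ℕ, (∀ i, k i < 2 ^ m₂) ∧
    x = ∑ i : Fin n, (k i : ℝ) * 2 ^ m₁ / ((2:ℝ) ^ (m₁ + m₂)) ^ (i.val + 1)}

/-- The Cantor-type set `X_n = A_n + [0, L^{-n}]`. -/
def Xset (m₁ m₂ n : ℕ) : Set ℝ :=
  {z | ∃ a ∈ Aset m₁ m₂ n, ∃ t ∈ Set.Icc (0:ℝ) ((((2:ℝ) ^ (m₁ + m₂)) ^ n)⁻¹), z = a + t}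

/-- The dilate `Y_n = L^n X_n ⊆ [0, L^n]`. -/
def Yset (m₁ m₂ n : ℕ) : Set ℝ :=
  (fun x => ((2:ℝ) ^ (m₁ + m₂)) ^ n * x) '' Xset m₁ m₂ n

/-! ### Binary digits -/

lemma rbit_eq_zero_or_one (x : ℝ) (k : ℤ) : rbit x k = 0 ∨ rbit x k = 1 := by
  unfold rbit
  omega

lemma rbit_ne_one_iff {x : ℝ} {k : ℤ} : rbit x k ≠ 1 ↔ rbit x k = 0 := by
  have := rbit_eq_zero_or_one x k
  omega

lemma rbit_eq_of_floor_eq {x y : ℝ} {k : ℤ} (h : ⌊x / (2:ℝ) ^ k⌋ = ⌊y / (2:ℝ) ^ k⌋) :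
    rbit x k = rbit y k := by
  simp only [rbit, h]

lemma floor_div_two_zpow_add (x : ℝ) (k : ℤ) (d : ℕ) :
    ⌊x / (2:ℝ) ^ (k + d)⌋ = ⌊x / (2:ℝ) ^ k⌋ / (2 ^ d : ℕ) := by
  rw [← Int.floor_div_natCast, zpow_add₀ two_ne_zero, ← div_div, zpow_natCast]
  norm_cast

lemma floor_div_two_zpow_eq_of_le {x y : ℝ} {k l : ℤ} (hkl : k ≤ l)
    (h : ⌊x / (2:ℝ) ^ k⌋ = ⌊y / (2:ℝ) ^ k⌋) : ⌊x / (2:ℝ) ^ l⌋ = ⌊y / (2:ℝ) ^ l⌋ := by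
  obtain ⟨d, rfl⟩ := Int.le.dest hkl
  rw [floor_div_two_zpow_add, floor_div_two_zpow_add, h]

lemma floor_div_two_zpow_eq (x : ℝ) (k : ℤ) :
    ⌊x / (2:ℝ) ^ k⌋ = 2 * ⌊x / (2:ℝ) ^ (k + 1)⌋ + rbit x k := by
  have h := floor_div_two_zpow_add x k 1
  simp only [Nat.cast_one, pow_one, Nat.cast_ofNat] at h
  rw [h, rbit]
  omega

lemma rbit_eq_zero_of_lt {x : ℝ} (hx : 0 ≤ x) {k : ℤ} (h : x < (2:ℝ) ^ k) : rbit x k = 0 := by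
  have : ⌊x / (2:ℝ) ^ k⌋ = 0 := by
    rw [Int.floor_eq_zero_iff]
    exact ⟨by positivity, (div_lt_one (by positivity)).2 h⟩
  simp [rbit, this]

lemma rbit_log {x : ℝ} (hx : 0 < x) : rbit x (Int.log 2 x) = 1 := by
  have h1 := Int.zpow_log_le_self (b := 2) (r := x) (by norm_num) hx
  have h2 := Int.lt_zpow_succ_log_self (b := 2) (by norm_num) x
  push_cast at h1 h2
  have : ⌊x / (2:ℝ) ^ Int.log 2 x⌋ = 1 := by
    rw [Int.floor_eq_iff]
    have hp : (0:ℝ) < (2:ℝ) ^ Int.log 2 x := by positivity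
    rw [zpow_add_one₀ two_ne_zero] at h2
    constructor
    · rw [le_div_iff₀ hp]; simpa using h1
    · rw [div_lt_iff₀ hp]; push_cast; linarith
  simp [rbit, this]

lemma rbit_eq_zero_of_log_lt {x : ℝ} (hx : 0 ≤ x) {k : ℤ} (h : Int.log 2 x < k) :
    rbit x k = 0 := by
  refine rbit_eq_zero_of_lt hx ?_
  have h2 := Int.lt_zpow_succ_log_self (b := 2) (by norm_num) x
  push_cast at h2
  exact h2.trans_le (zpow_le_zpow_right₀ one_le_two (by omega))

lemma le_log_of_rbit_eq_one {x : ℝ} (hx : 0 ≤ x) {k : ℤ} (h : rbit x k = 1) :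
    k ≤ Int.log 2 x := by
  by_contra! hk
  simp [rbit_eq_zero_of_log_lt hx hk] at h

lemma floor_add_two_zpow_div (x : ℝ) (j : ℤ) :
    ⌊(x + (2:ℝ) ^ j) / (2:ℝ) ^ j⌋ = ⌊x / (2:ℝ) ^ j⌋ + 1 := by
  rw [add_div, div_self (by positivity), Int.floor_add_one]

lemma rbit_add_two_zpow_self {x : ℝ} {j : ℤ} (h : rbit x j = 0) : rbit (x + (2:ℝ) ^ j) j = 1 := by
  unfold rbit at *
  rw [floor_add_two_zpow_div]
  omega

lemma rbit_add_two_zpow_of_ne {x : ℝ} {j k : ℤ} (h : rbit x j = 0) (hk : k ≠ j) :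
    rbit (x + (2:ℝ) ^ j) k = rbit x k := by
  rcases lt_or_gt_of_ne hk with hk | hk
  · obtain ⟨d, rfl⟩ := Int.le.dest (Int.add_one_le_of_lt hk)
    have : (x + (2:ℝ) ^ (k + 1 + d)) / (2:ℝ) ^ k = x / (2:ℝ) ^ k + ((2 * 2 ^ d : ℤ) : ℝ) := by
      rw [add_div, add_assoc, zpow_add₀ two_ne_zero, zpow_add₀ two_ne_zero, zpow_one,
        zpow_natCast]
      push_cast
      field_simp
    rw [rbit, this, Int.floor_add_intCast, Int.add_mul_emod_self_left, rbit]
  · apply rbit_eq_of_floor_eq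
    refine floor_div_two_zpow_eq_of_le (Int.add_one_le_of_lt hk) ?_
    have h1 := floor_div_two_zpow_eq (x + (2:ℝ) ^ j) j
    rw [floor_add_two_zpow_div, rbit_add_two_zpow_self h, floor_div_two_zpow_eq x j, h] at h1
    push_cast at h1
    omega

lemma eq_of_floor_div_two_zpow_eq {x y : ℝ} {K : ℤ}
    (h : ∀ d : ℕ, ⌊x / (2:ℝ) ^ (K - d)⌋ = ⌊y / (2:ℝ) ^ (K - d)⌋) : x = y := by
  have hlim : Filter.Tendsto (fun d : ℕ => (2:ℝ) ^ K * (1 / 2) ^ d) Filter.atTop (nhds 0) := by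
    simpa using (tendsto_pow_atTop_nhds_zero_of_lt_one (r := (1 / 2 : ℝ))
      (by norm_num) (by norm_num)).const_mul ((2:ℝ) ^ K)
  have habs : |x - y| ≤ 0 := by
    refine ge_of_tendsto' hlim fun d => ?_
    have h1 := Int.abs_sub_lt_one_of_floor_eq_floor (h d)
    have hp : (0:ℝ) < (2:ℝ) ^ (K - d) := by positivity
    rw [← sub_div, abs_div, abs_of_pos hp, div_lt_one hp, zpow_sub₀ two_ne_zero] at h1
    simpa [div_eq_mul_inv] using h1.le
  exact sub_eq_zero.1 (abs_nonpos_iff.1 habs)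

lemma measurable_rbit (k : ℤ) : Measurable fun x => rbit x k := by
  have : Measurable fun z : ℤ => (z % 2).toNat := measurable_from_top
  exact this.comp (Int.measurable_floor.comp (measurable_id.div_const _))

/-! ### Digits of the dyadic product -/

lemma finite_setOf_rbit_mul {x y : ℝ} (hx : 0 ≤ x) (hy : 0 ≤ y) (k : ℤ) :
    {j : ℤ | rbit x j = 1 ∧ rbit y (k - j) = 1}.Finite := by
  refine (Set.finite_Icc (k - Int.log 2 y) (Int.log 2 x)).subset fun j hj => ?_
  have h1 := le_log_of_rbit_eq_one hx hj.1
  have h2 := le_log_of_rbit_eq_one hy hj.2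
  exact ⟨by omega, h1⟩

lemma dprodDigit_eq_zero_of_lt {x y : ℝ} (hx : 0 ≤ x) (hy : 0 ≤ y) {k : ℤ}
    (hk : Int.log 2 x + Int.log 2 y < k) : dprodDigit x y k = 0 := by
  have : {j : ℤ | rbit x j = 1 ∧ rbit y (k - j) = 1} = ∅ := by
    refine Set.eq_empty_of_forall_notMem fun j hj => ?_
    have h1 := le_log_of_rbit_eq_one hx hj.1
    have h2 := le_log_of_rbit_eq_one hy hj.2
    omega
  simp [dprodDigit, this]

lemma dprodDigit_lt_two (x y : ℝ) (k : ℤ) : dprodDigit x y k < 2 :=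
  Nat.mod_lt _ two_pos

/-- Flipping one digit of the first factor flips a digit of the dyadic product. -/
lemma dprodDigit_add_of_flip {x x' y : ℝ} (hx : 0 ≤ x) (hy : 0 ≤ y) {k j : ℤ}
    (hj : rbit x j = 0) (hj' : rbit x' j = 1) (hyj : rbit y (k - j) = 1)
    (h : ∀ i ≠ j, rbit y (k - i) = 1 → rbit x' i = rbit x i) :
    dprodDigit x y k + dprodDigit x' y k = 1 := by
  have hset : {i : ℤ | rbit x' i = 1 ∧ rbit y (k - i) = 1} =
      insert j {i : ℤ | rbit x i = 1 ∧ rbit y (k - i) = 1} := by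
    ext i
    by_cases hi : i = j
    · subst hi; simp [hj', hyj]
    · have := h i hi
      simp only [Set.mem_ofPred_eq, Set.mem_insert_iff, hi, false_or]
      constructor
      · rintro ⟨h1, h2⟩; exact ⟨this h2 ▸ h1, h2⟩
      · rintro ⟨h1, h2⟩; exact ⟨(this h2).trans h1, h2⟩
  have hcard := Set.ncard_insert_of_notMem (a := j)
    (s := {i : ℤ | rbit x i = 1 ∧ rbit y (k - i) = 1}) (by simp [hj])
    (finite_setOf_rbit_mul hx hy k)
  unfold dprodDigit
  rw [hset, hcard]
  omega

/-- For fixed `y > 0`, the product `x ⊗ y` has a digit expansion ending in ones for at most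
countably many `x`. -/
lemma countable_setOf_dprodDigit_eq_one {y : ℝ} (hy : 0 < y) :
    {x : ℝ | 0 ≤ x ∧ ∀ k ≤ (-2 : ℤ), dprodDigit x y k = 1}.Countable := by
  set i := Int.log 2 y with hi
  suffices h : Set.InjOn (fun x : ℝ => ⌊x / (2:ℝ) ^ (-1 - i)⌋)
      {x : ℝ | 0 ≤ x ∧ ∀ k ≤ (-2 : ℤ), dprodDigit x y k = 1} from
    Set.MapsTo.countable_of_injOn (Set.mapsTo_univ _ _) h Set.countable_univ
  rintro x ⟨hx, hxk⟩ x' ⟨hx', hxk'⟩ hfl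
  refine eq_of_floor_div_two_zpow_eq (K := -1 - i) fun d => ?_
  induction d with
  | zero => simpa using hfl
  | succ d ih =>
    have hfl' : ∀ l, -1 - i - d ≤ l → rbit x l = rbit x' l := fun l hl =>
      rbit_eq_of_floor_eq (floor_div_two_zpow_eq_of_le hl ih)
    have hidx : -1 - i - ((d + 1 : ℕ) : ℤ) + 1 = -1 - i - d := by push_cast; ring
    rw [floor_div_two_zpow_eq x, floor_div_two_zpow_eq x', hidx, ih]
    congr 2
    set j : ℤ := -1 - i - ((d + 1 : ℕ) : ℤ) with hj
    have hk : -2 - (d : ℤ) ≤ -2 := by omega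
    have hyj : rbit y (-2 - (d : ℤ) - j) = 1 := by
      have : -2 - (d : ℤ) - j = i := by push_cast at hj; omega
      rw [this]
      exact rbit_log hy
    have hhigh : ∀ l ≠ j, rbit y (-2 - (d : ℤ) - l) = 1 → rbit x l = rbit x' l := by
      intro l hl h1
      have := le_log_of_rbit_eq_one hy.le h1
      push_cast at hj
      exact hfl' l (by omega)
    rcases rbit_eq_zero_or_one x j with h0 | h0 <;> rcases rbit_eq_zero_or_one x' j with h1 | h1
    · rw [h0, h1]
    · have := dprodDigit_add_of_flip hx hy.le h0 h1 hyj fun l hl hl' => (hhigh l hl hl').symm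
      rw [hxk _ hk, hxk' _ hk] at this
      omega
    · have := dprodDigit_add_of_flip hx' hy.le h1 h0 hyj hhigh
      rw [hxk _ hk, hxk' _ hk] at this
      omega
    · rw [h0, h1]

lemma hasSum_two_zpow_neg : HasSum (fun n : ℕ => (2:ℝ) ^ (-((n : ℤ) + 1 + 1))) (1 / 2) := by
  have h : (fun n : ℕ => (2:ℝ) ^ (-((n : ℤ) + 1 + 1))) = fun n => 1 / 4 * (1 / 2 : ℝ) ^ n := by
    funext n
    rw [zpow_neg, zpow_add₀ two_ne_zero, zpow_add₀ two_ne_zero, zpow_natCast, zpow_one, one_div,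
      one_div, inv_pow, mul_inv, mul_inv]
    ring
  rw [h]
  have h4 : (1 / 4 : ℝ) * 2 = 1 / 2 := by norm_num
  exact h4 ▸ hasSum_geometric_two.mul_left (1 / 4 : ℝ)

lemma rbit_neg_one_of_eq {A b : ℕ} {T z : ℝ} (hb : b < 2) (hT0 : 0 ≤ T) (hT : T < 1 / 2)
    (hz : z = A + (b / 2 + T)) : rbit z (-1) = b := by
  have hfloor : ⌊z / (2:ℝ) ^ (-1 : ℤ)⌋ = 2 * (A : ℤ) + b := by
    rw [Int.floor_eq_iff, hz, zpow_neg_one, div_inv_eq_mul]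
    push_cast
    constructor <;> linarith
  rw [rbit, hfloor]
  omega

/-- If the digits `c k` vanish for large `k` and are not all `1` below position `-1`, then the
digit of `∑ c k 2^k` in position `-1` is `c (-1)`. -/
lemma rbit_tsum_neg_one {c : ℤ → ℕ} (hc : ∀ k, c k < 2) {N : ℕ} (hN : ∀ k : ℤ, N ≤ k → c k = 0)
    {k₀ : ℤ} (hk₀ : k₀ ≤ -2) (hck₀ : c k₀ ≠ 1) :
    rbit (∑' k : ℤ, (c k : ℝ) * (2:ℝ) ^ k) (-1) = c (-1) := by
  set g : ℤ → ℝ := fun k => (c k : ℝ) * (2:ℝ) ^ k with hg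
  have hg0 : ∀ k, 0 ≤ g k := fun k => by positivity
  have hle : ∀ k, g k ≤ (2:ℝ) ^ k := fun k =>
    mul_le_of_le_one_left (by positivity) (by exact_mod_cast Nat.lt_succ_iff.1 (hc k))
  have hpos : ∀ n : ℕ, n ∉ Finset.range N → g n = 0 := fun n hn => by
    simp [hg, hN n (by simpa using hn)]
  have hgeom := hasSum_two_zpow_neg
  have hsum_tail : Summable fun n : ℕ => g (-((n : ℤ) + 1 + 1)) :=
    Summable.of_nonneg_of_le (fun n => hg0 _) (fun n => hle _) hgeom.summable
  have hsum_neg : Summable fun n : ℕ => g (-((n : ℤ) + 1)) := by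
    rw [← summable_nat_add_iff 1]
    exact_mod_cast hsum_tail
  have htail_lt : ∑' n : ℕ, g (-((n : ℤ) + 1 + 1)) < 1 / 2 := by
    rw [← hgeom.tsum_eq]
    obtain ⟨n₀, rfl⟩ : ∃ n₀ : ℕ, k₀ = -((n₀ : ℤ) + 1 + 1) := ⟨(-2 - k₀).toNat, by omega⟩
    refine Summable.tsum_lt_tsum (i := n₀) (fun n => hle _) ?_ hsum_tail hgeom.summable
    have h0 : c (-((n₀ : ℤ) + 1 + 1)) = 0 := by
      have := hc (-((n₀ : ℤ) + 1 + 1))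
      omega
    simp only [hg, h0, Nat.cast_zero, zero_mul]
    positivity
  refine rbit_neg_one_of_eq (A := ∑ n ∈ Finset.range N, c (n : ℤ) * 2 ^ n) (hc _)
    (tsum_nonneg fun n : ℕ => hg0 (-((n : ℤ) + 1 + 1))) htail_lt ?_
  rw [tsum_of_nat_of_neg_add_one (summable_of_ne_finset_zero hpos) hsum_neg,
    hsum_neg.tsum_eq_zero_add, tsum_eq_sum hpos]
  congr 1
  · simp [hg]
  · congr 1
    simp [hg, div_eq_mul_inv]

lemma eW_dprod_eq {x y : ℝ} (hx : 0 ≤ x) (hy : 0 ≤ y)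
    (h : ¬ ∀ k ≤ (-2 : ℤ), dprodDigit x y k = 1) :
    eW (dprod x y) = (-1) ^ dprodDigit x y (-1) := by
  push Not at h
  obtain ⟨k₀, hk₀, hck₀⟩ := h
  rw [eW, dprod, rbit_tsum_neg_one (dprodDigit_lt_two x y)
    (N := (Int.log 2 x + Int.log 2 y + 1).toNat) (fun k hk => ?_) hk₀ hck₀]
  exact dprodDigit_eq_zero_of_lt hx hy (by omega)

/-! ### Sets given by restricting the binary digits -/

/-- The nonnegative reals whose binary digits vanish outside the positions in `S`. -/
def digitSet (S : Set ℤ) : Set ℝ := {x | 0 ≤ x ∧ ∀ k ∉ S, rbit x k = 0}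

/-- The annihilator of a set of digit positions: the digit in position `k` of one factor pairs
with the digit in position `-1 - k` of the other. -/
def dualPositions (S : Set ℤ) : Set ℤ := {k | -1 - k ∉ S}

lemma dualPositions_dualPositions (S : Set ℤ) : dualPositions (dualPositions S) = S := by
  ext k
  simp [dualPositions]

lemma measurableSet_digitSet (S : Set ℤ) : MeasurableSet (digitSet S) := by
  have : digitSet S = Set.Ici 0 ∩ ⋂ k : ℤ, ⋂ _ : k ∉ S, {x | rbit x k = 0} := by
    ext x; simp [digitSet]
  rw [this]
  exact measurableSet_Ici.inter (.iInter fun k => .iInter fun _ =>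
    measurable_rbit k (measurableSet_singleton 0))

lemma preimage_add_digitSet {S : Set ℤ} {j : ℤ} (hj : j ∈ S) :
    (fun x : ℝ => x + (2:ℝ) ^ j) ⁻¹' (digitSet S ∩ {x | rbit x j = 1}) = digitSet (S \ {j}) := by
  ext x
  simp only [Set.mem_preimage, Set.mem_inter_iff, digitSet, Set.mem_ofPred_eq]
  have key (h0 : rbit x j = 0) : (∀ k ∉ S, rbit (x + (2:ℝ) ^ j) k = 0) ↔
      ∀ k ∉ S \ {j}, rbit x k = 0 := by
    refine forall_congr' fun k => ?_
    by_cases hk : k = j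
    · subst hk; simp [hj, h0]
    · simp [hk, rbit_add_two_zpow_of_ne h0 hk]
  constructor
  · rintro ⟨⟨h1, h2⟩, h3⟩
    have h3' := h3
    rw [rbit, floor_add_two_zpow_div] at h3'
    have hfl : 0 ≤ ⌊(x + (2:ℝ) ^ j) / (2:ℝ) ^ j⌋ := Int.floor_nonneg.2 (by positivity)
    rw [floor_add_two_zpow_div] at hfl
    have h0 : rbit x j = 0 := by unfold rbit; omega
    refine ⟨?_, (key h0).1 h2⟩
    have : 0 ≤ ⌊x / (2:ℝ) ^ j⌋ := by omega
    rw [Int.floor_nonneg] at this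
    by_contra! hneg
    exact absurd this (not_le.2 (div_neg_of_neg_of_pos hneg (by positivity)))
  · rintro ⟨h1, h2⟩
    have h0 : rbit x j = 0 := h2 j (by simp)
    exact ⟨⟨by positivity, (key h0).2 h2⟩, rbit_add_two_zpow_self h0⟩

lemma digitSet_sdiff_eq {S : Set ℤ} {j : ℤ} :
    digitSet S \ {x | rbit x j = 1} = digitSet (S \ {j}) := by
  ext x
  simp only [Set.mem_sdiff, digitSet, Set.mem_ofPred_eq]
  rw [← ne_eq, rbit_ne_one_iff, and_assoc]
  refine and_congr_right fun _ => ⟨fun ⟨h1, h2⟩ k hk => ?_, fun h => ⟨fun k hk => h k ?_, h j ?_⟩⟩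
  · by_cases hkj : k = j
    · rwa [hkj]
    · exact h1 k fun hkS => hk ⟨hkS, hkj⟩
  · exact fun h => hk h.1
  · simp

lemma measurableSet_rbit_eq_one (j : ℤ) : MeasurableSet {x | rbit x j = 1} :=
  measurable_rbit j (measurableSet_singleton 1)

lemma volume_digitSet {S : Set ℤ} {j : ℤ} (hj : j ∈ S) :
    volume (digitSet S) = 2 * volume (digitSet (S \ {j})) := by
  rw [← measure_inter_add_sdiff (digitSet S) (measurableSet_rbit_eq_one j), digitSet_sdiff_eq,
    ← measure_preimage_add_right volume ((2:ℝ) ^ j), preimage_add_digitSet hj, two_mul]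

lemma setIntegral_digitSet_eq_zero {S : Set ℤ} {j : ℤ} (hj : j ∈ S) {g : ℝ → ℂ}
    (hg : ∀ x ∈ digitSet (S \ {j}), g (x + (2:ℝ) ^ j) = - g x) :
    ∫ x in digitSet S, g x = 0 := by
  by_cases hint : IntegrableOn g (digitSet S)
  · rw [← integral_inter_add_sdiff (measurableSet_rbit_eq_one j) hint, digitSet_sdiff_eq,
      ← (measurePreserving_add_right volume ((2:ℝ) ^ j)).setIntegral_preimage_emb
        (measurableEmbedding_addRight _), preimage_add_digitSet hj,
      setIntegral_congr_fun (measurableSet_digitSet _) hg, integral_neg, neg_add_cancel]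
  · exact integral_undef hint

lemma digitSet_Iio_zero : digitSet (Set.Iio 0) = Set.Ico 0 1 := by
  ext x
  simp only [digitSet, Set.mem_Iio, not_lt, Set.mem_ofPred_eq, Set.mem_Ico]
  refine and_congr_right fun hx => ⟨fun h => ?_, fun h k hk => rbit_eq_zero_of_lt hx ?_⟩
  · by_contra! h1
    have h2 : 0 ≤ Int.log 2 x := by
      rw [← Int.zpow_le_iff_le_log (by norm_num) (by linarith)]
      simpa using h1
    have := h _ h2
    rw [rbit_log (by linarith)] at this
    omega
  · exact h.trans_le (one_le_zpow₀ one_le_two hk)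

lemma volume_digitSet_mul_dual (F : Finset ℤ) :
    volume (digitSet (Set.Iio 0 ∪ F)) * volume (digitSet (dualPositions (Set.Iio 0 ∪ F))) = 1 := by
  classical
  induction F using Finset.induction_on with
  | empty =>
    have : dualPositions (Set.Iio 0) = Set.Iio 0 := by
      ext k; simp only [dualPositions, Set.mem_Iio, Set.mem_ofPred_eq]; omega
    simp [this, digitSet_Iio_zero]
  | insert a F ha ih =>
    set S : Set ℤ := Set.Iio 0 ∪ F with hS
    have hins : Set.Iio 0 ∪ ((insert a F : Finset ℤ) : Set ℤ) = insert a S := by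
      rw [Finset.coe_insert, Set.union_insert]
    rw [hins]
    by_cases haS : a ∈ S
    · rwa [Set.insert_eq_of_mem haS]
    · have hdual : dualPositions (insert a S) = dualPositions S \ {-1 - a} := by
        ext k
        simp only [dualPositions, Set.mem_insert_iff, Set.mem_ofPred_eq, Set.mem_sdiff,
          Set.mem_singleton_iff, not_or]
        rw [and_comm]
        refine and_congr_right fun _ => not_congr ?_
        omega
      rw [volume_digitSet (S := insert a S) (Set.mem_insert a S),
        Set.insert_sdiff_self_of_notMem haS, hdual, mul_comm 2, mul_assoc,
        ← volume_digitSet (S := dualPositions S) (j := -1 - a) (by simpa [dualPositions] using haS)]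
      exact ih

/-! ### The Walsh transform of the indicator of a digit set -/

lemma walshTransform_congr {f g : ℝ → ℂ} (h : f =ᵐ[volume.restrict (Set.Ici (0:ℝ))] g) :
    walshTransform f = walshTransform g := by
  funext y
  refine integral_congr_ae ?_
  filter_upwards [h] with x hx
  rw [hx]

lemma walshTransform_const_mul (c : ℂ) (f : ℝ → ℂ) (y : ℝ) :
    walshTransform (fun x => c * f x) y = c * walshTransform f y := by
  simp only [walshTransform, ← integral_const_mul]
  refine integral_congr_ae (.of_forall fun x => ?_)
  simp only
  ring

lemma walshTransform_indicator_digitSet (S : Set ℤ) {y : ℝ} (hy : 0 < y) :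
    walshTransform ((digitSet S).indicator 1) y =
      (volume.real (digitSet S) : ℂ) * (digitSet (dualPositions S)).indicator 1 y := by
  have hH := measurableSet_digitSet S
  have hsub : digitSet S ⊆ Set.Ici 0 := fun x hx => hx.1
  have h1 : walshTransform ((digitSet S).indicator 1) y =
      ∫ x in digitSet S, (-1 : ℂ) ^ dprodDigit x y (-1) := by
    have h2 : ∀ x, (eW (dprod x y) : ℂ) * (digitSet S).indicator 1 x =
        (digitSet S).indicator (fun x => (eW (dprod x y) : ℂ)) x := fun x => by
      by_cases hx : x ∈ digitSet S <;> simp [hx]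
    simp only [walshTransform, h2]
    rw [setIntegral_indicator hH, Set.inter_eq_self_of_subset_right hsub]
    refine setIntegral_congr_ae hH ?_
    filter_upwards [(countable_setOf_dprodDigit_eq_one hy).ae_notMem volume] with x hx hxS
    rw [eW_dprod_eq hxS.1 hy.le fun h => hx ⟨hxS.1, h⟩]
    push_cast
    rfl
  rw [h1]
  by_cases hyS : y ∈ digitSet (dualPositions S)
  · rw [Set.indicator_of_mem hyS]
    have h3 : ∀ x ∈ digitSet S, (-1 : ℂ) ^ dprodDigit x y (-1) = 1 := by
      intro x hx
      have : {j : ℤ | rbit x j = 1 ∧ rbit y (-1 - j) = 1} = ∅ := by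
        refine Set.eq_empty_of_forall_notMem fun j hj => ?_
        have hjS : j ∈ S := by
          by_contra hjS
          have := hx.2 j hjS
          have := hj.1
          omega
        have h4 := hyS.2 (-1 - j) (by simpa [dualPositions] using hjS)
        have := hj.2
        omega
      simp [dprodDigit, this]
    rw [setIntegral_congr_fun hH h3]
    simp
  · rw [Set.indicator_of_notMem hyS, mul_zero]
    obtain ⟨k, hk, hyk⟩ : ∃ k ∉ dualPositions S, rbit y k = 1 := by
      by_contra! h
      exact hyS ⟨hy.le, fun k hk => rbit_ne_one_iff.1 (h k hk)⟩
    have hj : -1 - k ∈ S := by simpa [dualPositions] using hk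
    refine setIntegral_digitSet_eq_zero hj fun x hx => ?_
    have h0 : rbit x (-1 - k) = 0 := hx.2 _ (by simp)
    have hflip := dprodDigit_add_of_flip (k := -1) hx.1 hy.le h0 (rbit_add_two_zpow_self h0)
      (by simpa using hyk) fun i hi _ => rbit_add_two_zpow_of_ne h0 hi
    have hcases : dprodDigit x y (-1) = 0 ∨ dprodDigit x y (-1) = 1 := by omega
    rcases hcases with h | h
    · rw [h, show dprodDigit (x + (2:ℝ) ^ (-1 - k)) y (-1) = 1 by omega]; simp
    · rw [h, show dprodDigit (x + (2:ℝ) ^ (-1 - k)) y (-1) = 0 by omega]; simp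

/-! ### The Cantor-type sets -/

/-- The positions `0 ≤ p < (m₁ + m₂) n` of the binary digits that are free in the integer part of
an element of `Y_n`. -/
def cantorPositions (m₁ m₂ n : ℕ) : Finset ℕ :=
  {p ∈ Finset.range ((m₁ + m₂) * n) | m₁ ≤ p % (m₁ + m₂)}

lemma pow_succ_mul_add_div {L : ℝ} (hL : L ≠ 0) (T c : ℝ) (n : ℕ) :
    L ^ (n + 1) * (T + c / L ^ (n + 1)) = L * (L ^ n * T) + c := by
  field_simp
  ring

lemma exists_natCast_eq_of_digits (m₁ m₂ n : ℕ) (k : Fin n → ℕ) (hk : ∀ i, k i < 2 ^ m₂) :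
    ∃ N : ℕ, (N : ℝ) = ((2:ℝ) ^ (m₁ + m₂)) ^ n *
        ∑ i : Fin n, (k i : ℝ) * 2 ^ m₁ / ((2:ℝ) ^ (m₁ + m₂)) ^ (i.val + 1) ∧
      ∀ p, N.testBit p → p ∈ cantorPositions m₁ m₂ n := by
  induction n with
  | zero => exact ⟨0, by simp⟩
  | succ n ih =>
    obtain ⟨a, ha, hbit⟩ := ih (fun i => k i.castSucc) fun i => hk _
    have hlast := hk (Fin.last n)
    have hlt : 2 ^ m₁ * k (Fin.last n) < 2 ^ (m₁ + m₂) := by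
      rw [pow_add]
      exact Nat.mul_lt_mul_of_pos_left hlast (by positivity)
    refine ⟨2 ^ (m₁ + m₂) * a + 2 ^ m₁ * k (Fin.last n), ?_, fun p hp => ?_⟩
    · rw [Fin.sum_univ_castSucc]
      push_cast
      simp only [Fin.val_castSucc]
      rw [ha, pow_succ_mul_add_div (by positivity), mul_comm (2 ^ m₁ : ℝ)]
    · rw [Nat.testBit_two_pow_mul_add _ hlt] at hp
      simp only [cantorPositions, Finset.mem_filter, Finset.mem_range] at hbit ⊢
      split_ifs at hp with h
      · rw [Nat.testBit_two_pow_mul] at hp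
        simp only [Bool.and_eq_true, decide_eq_true_eq] at hp
        rw [Nat.mod_eq_of_lt h, mul_add, mul_one]
        exact ⟨by omega, hp.1⟩
      · have := hbit _ hp
        rw [← Nat.mod_eq_sub_mod (by omega)] at this
        rw [mul_add, mul_one]
        exact ⟨by omega, this.2⟩

lemma exists_digits_of_testBit (m₁ m₂ n : ℕ) (N : ℕ)
    (hN : ∀ p, N.testBit p → p ∈ cantorPositions m₁ m₂ n) :
    ∃ k : Fin n → ℕ, (∀ i, k i < 2 ^ m₂) ∧
      (N : ℝ) = ((2:ℝ) ^ (m₁ + m₂)) ^ n *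
        ∑ i : Fin n, (k i : ℝ) * 2 ^ m₁ / ((2:ℝ) ^ (m₁ + m₂)) ^ (i.val + 1) := by
  simp only [cantorPositions, Finset.mem_filter, Finset.mem_range] at hN
  induction n generalizing N with
  | zero =>
    have : N = 0 := Nat.eq_of_testBit_eq fun p => by
      have := hN p
      simp only [mul_zero, Nat.not_lt_zero, false_and, imp_false] at this
      simpa using this
    exact ⟨Fin.elim0, fun i => i.elim0, by simp [this]⟩
  | succ n ih =>
    obtain ⟨k, hk, hsum⟩ := ih (N / 2 ^ (m₁ + m₂)) fun p hp => by
      rw [Nat.testBit_div_two_pow] at hp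
      have := hN _ hp
      rw [Nat.add_mod_right, mul_add, mul_one] at this
      exact ⟨by omega, this.2⟩
    set r := N % 2 ^ (m₁ + m₂) with hr
    have hdvd : 2 ^ m₁ ∣ r := by
      refine Nat.dvd_of_mod_eq_zero (Nat.eq_of_testBit_eq fun p => ?_)
      rw [hr, Nat.testBit_mod_two_pow, Nat.testBit_mod_two_pow, Nat.zero_testBit]
      by_contra h
      simp only [Bool.not_eq_false, Bool.and_eq_true, decide_eq_true_eq] at h
      have := (hN p h.2.2).2
      rw [Nat.mod_eq_of_lt h.2.1] at this
      omega
    obtain ⟨q, hq⟩ := hdvd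
    have hq2 : q < 2 ^ m₂ := by
      have : r < 2 ^ (m₁ + m₂) := Nat.mod_lt _ (by positivity)
      rw [hq, pow_add] at this
      exact lt_of_mul_lt_mul_left this (by positivity)
    refine ⟨Fin.snoc k q, fun i => ?_, ?_⟩
    · refine Fin.lastCases ?_ (fun i => ?_) i
      · simpa using hq2
      · simpa using hk i
    · have hNeq : N = 2 ^ (m₁ + m₂) * (N / 2 ^ (m₁ + m₂)) + 2 ^ m₁ * q := by
        rw [← hq, hr, Nat.div_add_mod]
      rw [Fin.sum_univ_castSucc]
      simp only [Fin.snoc_castSucc, Fin.snoc_last, Fin.val_castSucc, Fin.val_last]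
      have hNeq' : (N : ℝ) = 2 ^ (m₁ + m₂) * ((N / 2 ^ (m₁ + m₂) : ℕ) : ℝ) + 2 ^ m₁ * q := by
        exact_mod_cast hNeq
      rw [hNeq', hsum, pow_succ_mul_add_div (by positivity), mul_comm (2 ^ m₁ : ℝ)]

lemma rbit_natCast_eq_one_iff {x : ℝ} (hx : 0 ≤ x) (p : ℕ) :
    rbit x p = 1 ↔ ⌊x⌋₊.testBit p := by
  have h := floor_div_two_zpow_add x 0 p
  rw [zpow_zero, div_one, zero_add, ← Int.natCast_floor_eq_floor hx] at h
  rw [rbit, h, Nat.testBit_eq_decide_div_mod_eq, decide_eq_true_eq]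
  norm_cast

/-- The positions of the binary digits that are free in an element of `Y_n`. -/
def freePositions (m₁ m₂ n : ℕ) : Set ℤ :=
  Set.Iio 0 ∪ ((cantorPositions m₁ m₂ n).map Nat.castEmbedding : Finset ℤ)

lemma natCast_mem_freePositions {m₁ m₂ n p : ℕ} :
    (p : ℤ) ∈ freePositions m₁ m₂ n ↔ p ∈ cantorPositions m₁ m₂ n := by
  simp [freePositions]

lemma mem_digitSet_freePositions {m₁ m₂ n : ℕ} {x : ℝ} (hx : 0 ≤ x) :
    x ∈ digitSet (freePositions m₁ m₂ n) ↔
      ∀ p, ⌊x⌋₊.testBit p → p ∈ cantorPositions m₁ m₂ n := by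
  simp only [digitSet, Set.mem_ofPred_eq, hx, true_and]
  constructor
  · intro h p hp
    by_contra hpS
    rw [← natCast_mem_freePositions] at hpS
    rw [← rbit_natCast_eq_one_iff hx, h _ hpS] at hp
    omega
  · intro h k hk
    have hk0 : 0 ≤ k := by
      by_contra! hk0
      exact hk (Or.inl hk0)
    lift k to ℕ using hk0
    rw [natCast_mem_freePositions] at hk
    rw [← rbit_ne_one_iff, ne_eq, rbit_natCast_eq_one_iff hx]
    exact fun hb => hk (h k hb)

lemma digitSet_subset_Yset (m₁ m₂ n : ℕ) : digitSet (freePositions m₁ m₂ n) ⊆ Yset m₁ m₂ n := by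
  intro x hx
  have hx0 : 0 ≤ x := hx.1
  obtain ⟨k, hk, hsum⟩ := exists_digits_of_testBit m₁ m₂ n _ ((mem_digitSet_freePositions hx0).1 hx)
  have hL : (0:ℝ) < ((2:ℝ) ^ (m₁ + m₂)) ^ n := by positivity
  refine ⟨_, ⟨_, ⟨k, hk, rfl⟩, (((2:ℝ) ^ (m₁ + m₂)) ^ n)⁻¹ * (x - ⌊x⌋₊), ⟨?_, ?_⟩, rfl⟩, ?_⟩
  · exact mul_nonneg (by positivity) (sub_nonneg.2 (Nat.floor_le hx0))
  · refine mul_le_of_le_one_right (by positivity) ?_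
    linarith [Nat.lt_floor_add_one x]
  · simp only
    rw [mul_add, ← hsum, mul_inv_cancel_left₀ hL.ne']
    ring

lemma Yset_subset_digitSet (m₁ m₂ n : ℕ) :
    Yset m₁ m₂ n ⊆ digitSet (freePositions m₁ m₂ n) ∪ Set.range ((↑) : ℕ → ℝ) := by
  rintro _ ⟨_, ⟨_, ⟨k, hk, rfl⟩, t, ⟨ht0, ht1⟩, rfl⟩, rfl⟩
  obtain ⟨N, hN, hbit⟩ := exists_natCast_eq_of_digits m₁ m₂ n k hk
  have hL : (0:ℝ) < ((2:ℝ) ^ (m₁ + m₂)) ^ n := by positivity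
  simp only [mul_add, ← hN]
  set u := ((2:ℝ) ^ (m₁ + m₂)) ^ n * t with hu
  have hu0 : 0 ≤ u := by positivity
  have hu1 : u ≤ 1 := by
    simpa [hL.ne'] using mul_le_mul_of_nonneg_left ht1 hL.le
  rcases hu1.lt_or_eq with h | h
  · left
    rw [mem_digitSet_freePositions (by positivity),
      show ⌊(N : ℝ) + u⌋₊ = N from (Nat.floor_eq_iff (by positivity)).2 ⟨by linarith, by linarith⟩]
    exact hbit
  · right
    exact ⟨N + 1, by rw [h]; push_cast; rfl⟩

lemma Yset_ae_eq (m₁ m₂ n : ℕ) :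
    Yset m₁ m₂ n =ᵐ[volume] digitSet (freePositions m₁ m₂ n) := by
  refine Filter.EventuallyLE.antisymm ?_ (digitSet_subset_Yset m₁ m₂ n).eventuallyLE
  filter_upwards [(Set.countable_range ((↑) : ℕ → ℝ)).ae_notMem volume] with x hx hxY
  exact (Yset_subset_digitSet m₁ m₂ n hxY).resolve_right hx

lemma rbit_two_pow_mul (x : ℝ) (d : ℕ) (k : ℤ) : rbit ((2:ℝ) ^ d * x) k = rbit x (k - d) := by
  have : (2:ℝ) ^ d * x / (2:ℝ) ^ k = x / (2:ℝ) ^ (k - d) := by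
    rw [zpow_sub₀ two_ne_zero, zpow_natCast]
    field_simp
  rw [rbit, this, rbit]

lemma digitSet_dual_subset_Xset {m₁ m₂ : ℕ} (hm₁ : 0 < m₁) (hm : m₁ ≤ m₂) (n : ℕ) :
    digitSet (dualPositions (freePositions m₁ m₂ n)) ⊆ Xset m₁ m₂ n := by
  intro x hx
  have hL : (0:ℝ) < ((2:ℝ) ^ (m₁ + m₂)) ^ n := by positivity
  suffices h : ((2:ℝ) ^ (m₁ + m₂)) ^ n * x ∈ digitSet (freePositions m₁ m₂ n) by
    obtain ⟨x', hx', heq⟩ := digitSet_subset_Yset m₁ m₂ n h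
    rwa [← mul_left_cancel₀ hL.ne' heq]
  refine ⟨mul_nonneg hL.le hx.1, fun k hk => ?_⟩
  rw [← pow_mul, rbit_two_pow_mul]
  refine hx.2 _ fun hdual => hk ?_
  have hk0 : 0 ≤ k := by
    by_contra! hk0
    exact hk (Or.inl hk0)
  lift k to ℕ using hk0
  have hlt : k < (m₁ + m₂) * n := by
    by_contra! hle
    exact hdual (Or.inl (by simp only [Set.mem_Iio]; omega))
  have hcast : -1 - ((k : ℤ) - (((m₁ + m₂) * n : ℕ) : ℤ)) = (((m₁ + m₂) * n - 1 - k : ℕ) : ℤ) := by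
    omega
  simp only [dualPositions, Set.mem_ofPred_eq, hcast] at hdual
  rw [natCast_mem_freePositions] at hdual hk
  simp only [cantorPositions, Finset.mem_filter, Finset.mem_range, not_and, not_le] at hdual hk
  have h1 := hk hlt
  have h2 := hdual (by omega)
  have hmod : ((m₁ + m₂) * n - 1 - k + (k + 1)) % (m₁ + m₂) = 0 := by
    rw [show (m₁ + m₂) * n - 1 - k + (k + 1) = (m₁ + m₂) * n by omega]
    simp
  rw [Nat.add_mod, Nat.add_mod k 1, Nat.mod_eq_of_lt (a := 1) (by omega),
    Nat.mod_eq_of_lt (a := k % _ + 1) (by omega), Nat.mod_eq_of_lt (by omega)] at hmod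
  omega

/-- The function `f = F_W(1_{Y_n})` is (a.e. on `[0,∞)`) supported on `X_n`, its Walsh
transform is (a.e.) `1_{Y_n}`; in particular `f` is a nonzero function supported on
`X_n` whose Walsh transform is supported on `Y_n`. -/
theorem walshTransform_indicator_Yset (m₁ m₂ : ℕ) (hm₁ : 0 < m₁) (hm : m₁ ≤ m₂)
    (n : ℕ) :
    let f : ℝ → ℂ := walshTransform ((Yset m₁ m₂ n).indicator 1)
    ¬ (f =ᵐ[volume.restrict (Set.Ici (0:ℝ))] 0) ∧
    (∀ᵐ x ∂(volume.restrict (Set.Ici (0:ℝ))), x ∉ Xset m₁ m₂ n → f x = 0) ∧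
    (∀ᵐ y ∂(volume.restrict (Set.Ici (0:ℝ))),
      walshTransform f y = (Yset m₁ m₂ n).indicator 1 y) ∧
    (∀ᵐ y ∂(volume.restrict (Set.Ici (0:ℝ))),
      y ∉ Yset m₁ m₂ n → walshTransform f y = 0) := by

  intro f
  set S := freePositions m₁ m₂ n with hS
  set V := volume.real (digitSet S) with hV
  have hvol : volume (digitSet S) * volume (digitSet (dualPositions S)) = 1 :=
    volume_digitSet_mul_dual _
  have hV1 : V * volume.real (digitSet (dualPositions S)) = 1 := by
    rw [hV, measureReal_def, measureReal_def, ← ENNReal.toReal_mul, hvol, ENNReal.toReal_one]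
  have hpos : ∀ᵐ y ∂(volume.restrict (Set.Ici (0:ℝ))), 0 < y := by
    rw [← restrict_Ioi_eq_restrict_Ici]
    exact ae_restrict_mem measurableSet_Ioi
  have hind : (Yset m₁ m₂ n).indicator (1 : ℝ → ℂ) =ᵐ[volume.restrict (Set.Ici (0:ℝ))]
      (digitSet S).indicator 1 :=
    ae_restrict_of_ae (indicator_ae_eq_of_ae_eq_set (Yset_ae_eq m₁ m₂ n))
  have hf : ∀ y, 0 < y → f y = (V : ℂ) * (digitSet (dualPositions S)).indicator 1 y := fun y hy => by
    simp only [f]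
    rw [walshTransform_congr hind, walshTransform_indicator_digitSet S hy]
  have hinv : ∀ᵐ y ∂(volume.restrict (Set.Ici (0:ℝ))),
      walshTransform f y = (Yset m₁ m₂ n).indicator 1 y := by
    filter_upwards [hpos, hind] with y hy hyind
    rw [walshTransform_congr (hpos.mono hf), walshTransform_const_mul,
      walshTransform_indicator_digitSet _ hy, dualPositions_dualPositions, ← mul_assoc, hyind]
    rw [← Complex.ofReal_mul, hV1, Complex.ofReal_one, one_mul]
  refine ⟨fun h0 => ?_, ?_, hinv, ?_⟩
  · have hnull : ∀ᵐ y ∂(volume.restrict (Set.Ici (0:ℝ))), y ∉ digitSet (dualPositions S) := by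
      filter_upwards [hpos, h0] with y hy hy0 hyS
      rw [hf y hy, Set.indicator_of_mem hyS] at hy0
      have hV0 : V = 0 := by simpa using hy0
      simp [hV0] at hV1
    rw [ae_restrict_iff' measurableSet_Ici] at hnull
    have hzero : volume (digitSet (dualPositions S)) = 0 := by
      refine measure_mono_null (fun y hy => ?_) hnull
      simpa using ⟨hy.1, hy⟩
    simp [hzero] at hvol
  · filter_upwards [hpos] with x hx hxX
    rw [hf x hx, Set.indicator_of_notMem fun h => hxX (digitSet_dual_subset_Xset hm₁ hm n h),
      mul_zero]
  · filter_upwards [hinv] with y hy hyY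
    rw [hy, Set.indicator_of_notMem hyY]

end
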